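/- Let A be a third-order tensor in ℂ^{n₁×n₁×n₃} with ind(A) = k. Then A admits a core-nilpotent decomposition with respect to the M-product: there exists a ⋆-invertible tensor P ∈ ℂ^{n₁×n₁×n₃} such that for every i = 1,…,n₃ the i-th frontal slice of the mode-3 transform of P⁻¹ ⋆ A ⋆ P is a block-diagonal matrix diag(U^{(i)}, N^{(i)}), where each U^{(i)} is an invertible matrix and each N^{(i)} is a nilpotent matrix. -/

import Mathlib

open Matrix BigOperators

/-- A third-order complex tensor in `ℂ^{n₁ × n₂ × n₃}`, given by its frontal slices. -/
abbrev Tensor3 (n₁ n₂ n₃ : ℕ) := Fin n₃ → Matrix (Fin n₁) (Fin n₂) ℂ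

/-- Mode-3 product of a tensor with an `n₃ × n₃` matrix: the slices of the result are the
indicated linear combinations of the slices of `A`. -/
noncomputable def mode3 {n₁ n₂ n₃ : ℕ} (M : Matrix (Fin n₃) (Fin n₃) ℂ) (A : Tensor3 n₁ n₂ n₃) :
    Tensor3 n₁ n₂ n₃ :=
  fun i => ∑ j, M i j • A j

/-- The M-product `A ⋆_M B`: slice-wise matrix product in the transformed (hat) domain,
transformed back by `M⁻¹`. -/
noncomputable def mprod {n₁ n₂ l n₃ : ℕ} (M : Matrix (Fin n₃) (Fin n₃) ℂ)
    (A : Tensor3 n₁ n₂ n₃) (B : Tensor3 n₂ l n₃) : Tensor3 n₁ l n₃ :=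
  mode3 M⁻¹ (fun i => mode3 M A i * mode3 M B i)

/-- The identity tensor: every slice of its mode-3 transform is the identity matrix. -/
noncomputable def idT (n₁ : ℕ) {n₃ : ℕ} (M : Matrix (Fin n₃) (Fin n₃) ℂ) : Tensor3 n₁ n₁ n₃ :=
  mode3 M⁻¹ (fun _ => (1 : Matrix (Fin n₁) (Fin n₁) ℂ))

/-- Powers of a square tensor with respect to the M-product. -/
noncomputable def mpow {n₁ n₃ : ℕ} (M : Matrix (Fin n₃) (Fin n₃) ℂ) (A : Tensor3 n₁ n₁ n₃) :
    ℕ → Tensor3 n₁ n₁ n₃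
  | 0 => idT n₁ M
  | k + 1 => mprod M (mpow M A k) A

/-- Conjugate transpose with respect to the M-product: slice-wise conjugate transpose in the
transformed domain. -/
noncomputable def ctrans {n₁ n₂ n₃ : ℕ} (M : Matrix (Fin n₃) (Fin n₃) ℂ) (A : Tensor3 n₁ n₂ n₃) :
    Tensor3 n₂ n₁ n₃ :=
  mode3 M⁻¹ (fun i => (mode3 M A i)ᴴ)

/-- Index of a square complex matrix: the least `k ≥ 0` with `rank(B^k) = rank(B^{k+1})`. -/
noncomputable def matIndex {n : ℕ} (B : Matrix (Fin n) (Fin n) ℂ) : ℕ :=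
  sInf {k : ℕ | (B ^ k).rank = (B ^ (k + 1)).rank}

/-- Index of a tensor: the maximum of the indices of the slices of its mode-3 transform. -/
noncomputable def tIndex {n₁ n₃ : ℕ} (M : Matrix (Fin n₃) (Fin n₃) ℂ)
    (A : Tensor3 n₁ n₁ n₃) : ℕ :=
  Finset.univ.sup fun i => matIndex (mode3 M A i)

/-- `X` is a GD inverse of `A` with exponent `k`:
`A ⋆ X ⋆ A = A`, `X ⋆ A^{k+1} = A^k`, `A^{k+1} ⋆ X = A^k`. -/
def IsGD {n₁ n₃ : ℕ} (M : Matrix (Fin n₃) (Fin n₃) ℂ) (A X : Tensor3 n₁ n₁ n₃)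
    (k : ℕ) : Prop :=
  mprod M (mprod M A X) A = A ∧
  mprod M X (mpow M A (k + 1)) = mpow M A k ∧
  mprod M (mpow M A (k + 1)) X = mpow M A k

/-- `X` is the Drazin inverse of `A` with exponent `k`. -/
def IsDrazin {n₁ n₃ : ℕ} (M : Matrix (Fin n₃) (Fin n₃) ℂ) (A X : Tensor3 n₁ n₁ n₃)
    (k : ℕ) : Prop :=
  mprod M X (mpow M A (k + 1)) = mpow M A k ∧
  mprod M (mprod M X A) X = X ∧
  mprod M X A = mprod M A X

/-- `X` is the Moore–Penrose inverse of `A`. -/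
def IsMP {n₁ n₃ : ℕ} (M : Matrix (Fin n₃) (Fin n₃) ℂ) (A X : Tensor3 n₁ n₁ n₃) : Prop :=
  mprod M (mprod M A X) A = A ∧
  mprod M (mprod M X A) X = X ∧
  ctrans M (mprod M A X) = mprod M A X ∧
  ctrans M (mprod M X A) = mprod M X A

theorem LinearMap.toMatrix_reindex_self {R V ι κ : Type*} [CommSemiring R] [AddCommMonoid V]
    [Module R V] [Fintype ι] [DecidableEq ι] [Fintype κ] [DecidableEq κ]
    (b : Module.Basis ι R V) (e : ι ≃ κ) (f : Module.End R V) :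
    LinearMap.toMatrix (b.reindex e) (b.reindex e) f =
      Matrix.reindex e e (LinearMap.toMatrix b b f) := by
  ext i j
  simp [LinearMap.toMatrix_apply]

/-- In a basis adapted to complementary invariant subspaces an endomorphism is block diagonal. -/
theorem LinearMap.toMatrix_prodEquivOfIsCompl {K V ι κ : Type*} [CommRing K] [AddCommGroup V]
    [Module K V] [Fintype ι] [DecidableEq ι] [Fintype κ] [DecidableEq κ]
    {p q : Submodule K V} (h : IsCompl p q) (f : Module.End K V)
    (hp : ∀ x ∈ p, f x ∈ p) (hq : ∀ x ∈ q, f x ∈ q)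
    (bp : Module.Basis ι K p) (bq : Module.Basis κ K q) :
    LinearMap.toMatrix ((bp.prod bq).map (p.prodEquivOfIsCompl q h))
        ((bp.prod bq).map (p.prodEquivOfIsCompl q h)) f =
      Matrix.fromBlocks (LinearMap.toMatrix bp bp (f.restrict hp)) 0 0
        (LinearMap.toMatrix bq bq (f.restrict hq)) := by
  rw [← LinearMap.toMatrix_prodMap, LinearMap.toMatrix_map_left, LinearMap.toMatrix_map_right]
  congr 1
  refine LinearMap.ext fun x => ?_
  simp only [LinearMap.comp_apply, LinearEquiv.coe_coe]
  rw [LinearEquiv.symm_apply_eq]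
  simp

/-- Fitting's decomposition of an endomorphism of a finite-dimensional space. -/
theorem LinearMap.exists_isCompl_isUnit_restrict_isNilpotent_restrict {K V : Type*} [Field K]
    [AddCommGroup V] [Module K V] [FiniteDimensional K V] (f : Module.End K V) :
    ∃ (p q : Submodule K V) (_ : IsCompl p q) (hp : ∀ x ∈ p, f x ∈ p) (hq : ∀ x ∈ q, f x ∈ q),
      IsUnit (f.restrict hp) ∧ IsNilpotent (f.restrict hq) := by
  obtain ⟨m, hm, hm1⟩ :=
    (f.eventually_isCompl_ker_pow_range_pow.and (Filter.eventually_ge_atTop 1)).exists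
  have hcomm (x : V) : (f ^ m) (f x) = f ((f ^ m) x) := by
    rw [← Module.End.mul_apply, ← Module.End.mul_apply, ← pow_succ, ← pow_succ']
  have hp : ∀ x ∈ LinearMap.range (f ^ m), f x ∈ LinearMap.range (f ^ m) := by
    rintro _ ⟨y, rfl⟩
    exact ⟨f y, hcomm y⟩
  have hq : ∀ x ∈ LinearMap.ker (f ^ m), f x ∈ LinearMap.ker (f ^ m) := by
    intro x hx
    rw [LinearMap.mem_ker] at hx ⊢
    rw [hcomm, hx, map_zero]
  refine ⟨_, _, hm.symm, hp, hq, ?_, m, ?_⟩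
  · rw [LinearMap.isUnit_iff_ker_eq_bot, LinearMap.ker_eq_bot']
    intro x hx
    have hfx : f x = 0 := congrArg Subtype.val hx
    have hker : (x : V) ∈ LinearMap.ker (f ^ m) := by
      exact Module.End.pow_map_zero_of_le hm1 (by simpa using hfx)
    exact Subtype.ext (Submodule.disjoint_def.mp hm.disjoint _ hker x.2)
  · rw [Module.End.pow_restrict]
    exact LinearMap.ext fun x => Subtype.ext x.2

/-- Core-nilpotent decomposition of a square matrix over a field. -/
theorem Matrix.exists_core_nilpotent_decomposition {K : Type*} [Field K] {n : ℕ}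
    (B : Matrix (Fin n) (Fin n) K) :
    ∃ P Q : Matrix (Fin n) (Fin n) K, P * Q = 1 ∧ Q * P = 1 ∧
      ∃ (r : ℕ) (hr : r ≤ n)
        (U : Matrix (Fin r) (Fin r) K) (N : Matrix (Fin (n - r)) (Fin (n - r)) K),
        IsUnit U ∧ IsNilpotent N ∧
        Q * B * P =
          Matrix.reindex (finSumFinEquiv.trans (finCongr (Nat.add_sub_cancel' hr)))
            (finSumFinEquiv.trans (finCongr (Nat.add_sub_cancel' hr)))
            (Matrix.fromBlocks U 0 0 N) := by
  obtain ⟨p, q, h, hp, hq, hU, hN⟩ :=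
    LinearMap.exists_isCompl_isUnit_restrict_isNilpotent_restrict (Matrix.toLin' B)
  have hdim : Module.finrank K p + Module.finrank K q = n := by
    simpa using Submodule.finrank_add_eq_of_isCompl h
  have hr : Module.finrank K p ≤ n := by omega
  let bp := Module.finBasis K p
  have hs : Module.finrank K q = n - Module.finrank K p := by omega
  let bq := Module.finBasisOfFinrankEq K q hs
  let b := ((bp.prod bq).map (p.prodEquivOfIsCompl q h)).reindex
    (finSumFinEquiv.trans (finCongr (Nat.add_sub_cancel' hr)))
  let c := Pi.basisFun K (Fin n)
  refine ⟨c.toMatrix b, b.toMatrix c, c.toMatrix_mul_toMatrix_flip b,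
    b.toMatrix_mul_toMatrix_flip c, _, hr, LinearMap.toMatrix bp bp (LinearMap.restrict _ hp),
    LinearMap.toMatrix bq bq (LinearMap.restrict _ hq),
    (LinearMap.isUnit_toMatrix_iff bp).mpr hU,
    (LinearMap.isNilpotent_toMatrix_iff bq _).mpr hN, ?_⟩
  rw [← LinearMap.toMatrix_prodEquivOfIsCompl h, ← LinearMap.toMatrix_reindex_self,
    ← basis_toMatrix_mul_linearMap_toMatrix_mul_basis_toMatrix b c b c]
  congr 2
  exact (LinearMap.toMatrix'_toLin' B).symm

theorem mode3_mode3 {n₁ n₂ n₃ : ℕ} (M L : Matrix (Fin n₃) (Fin n₃) ℂ) (A : Tensor3 n₁ n₂ n₃) :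
    mode3 M (mode3 L A) = mode3 (M * L) A := by
  funext i
  simp only [mode3, Finset.smul_sum, smul_smul, Matrix.mul_apply, Finset.sum_smul]
  exact Finset.sum_comm

theorem mode3_one {n₁ n₂ n₃ : ℕ} (A : Tensor3 n₁ n₂ n₃) : mode3 1 A = A := by
  funext i
  simp [mode3, Matrix.one_apply, ite_smul]

theorem mode3_mode3_inv {n₁ n₂ n₃ : ℕ} {M : Matrix (Fin n₃) (Fin n₃) ℂ} (hM : IsUnit M)
    (A : Tensor3 n₁ n₂ n₃) : mode3 M (mode3 M⁻¹ A) = A := by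
  rw [mode3_mode3, Matrix.mul_nonsing_inv _ ((Matrix.isUnit_iff_isUnit_det M).mp hM), mode3_one]

/-- every square third-order tensor of index `k` admits a core-nilpotent
decomposition with respect to the M-product: there is a ⋆-invertible tensor `P` such that every
frontal slice of the mode-3 transform of `P⁻¹ ⋆ A ⋆ P` is block diagonal `diag(U, N)` with `U`
invertible and `N` nilpotent. -/
theorem core_nilpotent_decomposition {n₁ n₃ : ℕ} (hn₁ : 0 < n₁) (hn₃ : 0 < n₃)
    (M : Matrix (Fin n₃) (Fin n₃) ℂ) (hM : IsUnit M)
    (A : Tensor3 n₁ n₁ n₃) (k : ℕ) (hk : tIndex M A = k) :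
    ∃ P Pinv : Tensor3 n₁ n₁ n₃,
      mprod M P Pinv = idT n₁ M ∧ mprod M Pinv P = idT n₁ M ∧
      ∀ i : Fin n₃, ∃ (r : ℕ) (hr : r ≤ n₁)
        (U : Matrix (Fin r) (Fin r) ℂ) (N : Matrix (Fin (n₁ - r)) (Fin (n₁ - r)) ℂ),
        IsUnit U ∧ IsNilpotent N ∧
        mode3 M (mprod M (mprod M Pinv A) P) i =
          Matrix.reindex (finSumFinEquiv.trans (finCongr (Nat.add_sub_cancel' hr)))
            (finSumFinEquiv.trans (finCongr (Nat.add_sub_cancel' hr)))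
            (Matrix.fromBlocks U 0 0 N) := by
  choose P Q hPQ hQP h using fun i => Matrix.exists_core_nilpotent_decomposition (mode3 M A i)
  refine ⟨mode3 M⁻¹ P, mode3 M⁻¹ Q, ?_, ?_, fun i => ?_⟩
  · simp only [mprod, idT, mode3_mode3_inv hM, hPQ]
  · simp only [mprod, idT, mode3_mode3_inv hM, hQP]
  · simpa only [mprod, mode3_mode3_inv hM] using h i
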